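/- arXiv:0711.2867 — 3 statements merged into one kernel-verified Lean document; each statement's English description precedes it below -/
import Mathlib

section
/- For every node i ∈ N, v_i ≤ 1 + c·v_i (equivalently v_i ≤ 1/(1−c)), and equality v_i = 1/(1−c) holds if and only if the node i does not have access to Ī. -/
open Matrix Finset

/-- Outdegree of node `i` in the edge set `E`. -/
def outdeg {n : ℕ} (E : Finset (Fin n × Fin n)) (i : Fin n) : ℕ :=
  (Finset.univ.filter (fun j => (i, j) ∈ E)).card

/-- The scaled adjacency matrix `P` of the graph: `P i j = 1 / outdeg i` if `(i,j) ∈ E`. -/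
noncomputable def Pmat {n : ℕ} (E : Finset (Fin n × Fin n)) : Matrix (Fin n) (Fin n) ℝ :=
  fun i j => if (i, j) ∈ E then ((outdeg E i : ℝ))⁻¹ else 0

/-- Indicator vector of a set of nodes. -/
def ind {n : ℕ} (I : Finset (Fin n)) : Fin n → ℝ :=
  fun i => if i ∈ I then 1 else 0

/-- `v = (Id - cP)⁻¹ e_I`, the vector of mean numbers of visits to `I` before zapping. -/
noncomputable def vvec {n : ℕ} (c : ℝ) (E : Finset (Fin n × Fin n)) (I : Finset (Fin n)) : Fin n → ℝ :=
  (1 - c • Pmat E)⁻¹ *ᵥ ind I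

/-- PageRank vector `πᵀ = (1-c) zᵀ (Id - cP)⁻¹`. -/
noncomputable def pr {n : ℕ} (c : ℝ) (z : Fin n → ℝ) (E : Finset (Fin n × Fin n)) : Fin n → ℝ :=
  (1 - c) • (((1 - c • Pmat E)⁻¹)ᵀ *ᵥ z)

/-- PageRank of the set `I`: `πᵀ e_I`. -/
noncomputable def prSet {n : ℕ} (c : ℝ) (z : Fin n → ℝ) (E : Finset (Fin n × Fin n))
    (I : Finset (Fin n)) : ℝ :=
  ∑ i ∈ I, pr c z E i

/-- Node `i` has access to (some node of) the set `J`: `i ∈ J` or a directed path from `i`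
reaches `J`. -/
def access {n : ℕ} (E : Finset (Fin n × Fin n)) (i : Fin n) (J : Finset (Fin n)) : Prop :=
  ∃ j ∈ J, Relation.ReflTransGen (fun a b => (a, b) ∈ E) i j


lemma Pmat_nonneg {n : ℕ} (E : Finset (Fin n × Fin n)) (i j : Fin n) : 0 ≤ Pmat E i j := by
  unfold Pmat; split_ifs <;> positivity

lemma Pmat_sum {n : ℕ} (E : Finset (Fin n × Fin n)) (hE : ∀ i, 0 < outdeg E i) (i : Fin n) :
    ∑ j, Pmat E i j = 1 := by
  have h : ((outdeg E i : ℕ) : ℝ) ≠ 0 := by exact_mod_cast (hE i).ne'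
  unfold Pmat
  rw [← Finset.sum_filter, Finset.sum_const, nsmul_eq_mul]
  exact mul_inv_cancel₀ h

/-- Minimum principle. -/
lemma min_principle {n : ℕ} (E : Finset (Fin n × Fin n)) (hE : ∀ i, 0 < outdeg E i) (c : ℝ)
    (hc0 : 0 < c) (hc1 : c < 1) (x : Fin n → ℝ)
    (hx : ∀ i, c * ∑ j, Pmat E i j * x j ≤ x i) (i : Fin n) : 0 ≤ x i := by
  obtain ⟨m, -, hm⟩ := Finset.exists_min_image Finset.univ x ⟨i, Finset.mem_univ i⟩
  have h1 : x m ≤ ∑ j, Pmat E m j * x j := by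
    calc x m = ∑ j, Pmat E m j * x m := by rw [← Finset.sum_mul, Pmat_sum E hE, one_mul]
      _ ≤ _ := Finset.sum_le_sum fun j hj =>
        mul_le_mul_of_nonneg_left (hm j hj) (Pmat_nonneg E m j)
  have h2 := hx m
  have h3 := hm i (Finset.mem_univ i)
  have h4 := mul_le_mul_of_nonneg_left h1 hc0.le
  nlinarith

lemma apply_eq {n : ℕ} (E : Finset (Fin n × Fin n)) (c : ℝ) (x : Fin n → ℝ) (i : Fin n) :
    ((1 - c • Pmat E) *ᵥ x) i = x i - c * ∑ j, Pmat E i j * x j := by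
  rw [Matrix.sub_mulVec, Matrix.one_mulVec, Matrix.smul_mulVec]
  rfl

lemma isUnit_det {n : ℕ} (E : Finset (Fin n × Fin n)) (hE : ∀ i, 0 < outdeg E i) (c : ℝ)
    (hc0 : 0 < c) (hc1 : c < 1) : IsUnit (1 - c • Pmat E).det := by
  rw [isUnit_iff_ne_zero]
  intro h
  obtain ⟨x, hx0, hx⟩ := Matrix.exists_mulVec_eq_zero_iff.mpr h
  apply hx0
  have key : ∀ i, x i - c * ∑ j, Pmat E i j * x j = 0 := fun i => by
    rw [← apply_eq, hx]; rfl
  funext i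
  have h1 := min_principle E hE c hc0 hc1 x (fun i => by linarith [key i]) i
  have h2 := min_principle E hE c hc0 hc1 (fun i => - x i) (fun i => by
    simp only [mul_neg, Finset.sum_neg_distrib]; linarith [key i]) i
  simp only [Pi.zero_apply]
  linarith

lemma vvec_eq {n : ℕ} (E : Finset (Fin n × Fin n)) (hE : ∀ i, 0 < outdeg E i) (c : ℝ)
    (hc0 : 0 < c) (hc1 : c < 1) (I : Finset (Fin n)) (i : Fin n) :
    vvec c E I i - c * ∑ j, Pmat E i j * vvec c E I j = ind I i := by
  rw [← apply_eq, vvec, Matrix.mulVec_mulVec,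
    Matrix.mul_nonsing_inv _ (isUnit_det E hE c hc0 hc1), Matrix.one_mulVec]

/-- Lemma 1(b): for every node `i`, `v i ≤ 1 + c * v i` (equivalently `v i ≤ 1/(1-c)`),
with equality `v i = 1/(1-c)` if and only if `i` does not have access to the complement
of `I`. -/
theorem stmt1 {n : ℕ} (hn : 1 ≤ n) (E : Finset (Fin n × Fin n))
    (hE : ∀ i, 0 < outdeg E i) (c : ℝ) (hc0 : 0 < c) (hc1 : c < 1)
    (I : Finset (Fin n)) :
    ∀ i : Fin n,
      vvec c E I i ≤ 1 + c * vvec c E I i ∧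
      (vvec c E I i = 1 / (1 - c) ↔ ¬ access E i Iᶜ) := by
  have hc : 0 < 1 - c := by linarith
  obtain ⟨w, hw⟩ : ∃ w : Fin n → ℝ, ∀ i, w i = 1 / (1 - c) - vvec c E I i := ⟨_, fun _ => rfl⟩
  have hweq : ∀ i, w i = c * ∑ j, Pmat E i j * w j + (1 - ind I i) := by
    intro i
    have h := vvec_eq E hE c hc0 hc1 I i
    have h2 : ∑ j, Pmat E i j * w j = 1 / (1 - c) - ∑ j, Pmat E i j * vvec c E I j := by
      simp only [hw, mul_sub, Finset.sum_sub_distrib]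
      rw [← Finset.sum_mul, Pmat_sum E hE, one_mul]
    have h3 : 1 / (1 - c) - c * (1 / (1 - c)) = 1 := by field_simp
    rw [h2, hw]
    linarith
  have hb : ∀ i, 0 ≤ 1 - ind I i := by
    intro i; unfold ind; split_ifs <;> norm_num
  have hw0 : ∀ i, 0 ≤ w i :=
    min_principle E hE c hc0 hc1 w (fun i => by linarith [hweq i, hb i])
  have hsum0 : ∀ i, 0 ≤ ∑ j, Pmat E i j * w j := fun i =>
    Finset.sum_nonneg fun j _ => mul_nonneg (Pmat_nonneg E i j) (hw0 j)
  have hiff : ∀ i, w i = 0 ↔ ¬ access E i Iᶜ := by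
    intro i
    constructor
    · rintro h0 ⟨j, hj, hp⟩
      have hj0 : w j = 0 := by
        clear hj
        induction hp with
        | refl => exact h0
        | @tail a b _ hab ih =>
          have h1 : ∑ j, Pmat E a j * w j = 0 := by
            have := hweq a
            have := hb a
            have := hsum0 a
            nlinarith
          have h2 := (Finset.sum_eq_zero_iff_of_nonneg
            (fun j _ => mul_nonneg (Pmat_nonneg E a j) (hw0 j))).mp h1 b (Finset.mem_univ b)
          rcases mul_eq_zero.mp h2 with h3 | h3
          · exfalso
            have h4 : ((outdeg E a : ℕ) : ℝ) ≠ 0 := by exact_mod_cast (hE a).ne'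
            unfold Pmat at h3
            rw [if_pos hab] at h3
            exact inv_ne_zero h4 h3
          · exact h3
      have h5 := hweq j
      have h6 : ind I j = 0 := by unfold ind; exact if_neg (Finset.mem_compl.mp hj)
      have := mul_nonneg hc0.le (hsum0 j)
      linarith
    · intro hi
      classical
      have := min_principle E hE c hc0 hc1 (fun k => if access E k Iᶜ then 0 else - w k)
        (fun k => by
          by_cases hk : access E k Iᶜ
          · simp only [if_pos hk]
            apply mul_nonpos_of_nonneg_of_nonpos hc0.le
            apply Finset.sum_nonpos
            intro j _
            apply mul_nonpos_of_nonneg_of_nonpos (Pmat_nonneg E k j)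
            split_ifs
            · exact le_rfl
            · linarith [hw0 j]
          · simp only [if_neg hk]
            have h1 : ∀ j, Pmat E k j * (if access E j Iᶜ then 0 else - w j)
                = - (Pmat E k j * w j) := by
              intro j
              by_cases hkj : (k, j) ∈ E
              · rw [if_neg]
                · ring
                · rintro ⟨l, hl, hp⟩
                  exact hk ⟨l, hl, Relation.ReflTransGen.head hkj hp⟩
              · have : Pmat E k j = 0 := by unfold Pmat; exact if_neg hkj
                simp [this]
            have h2 : ind I k = 1 := by
              unfold ind
              apply if_pos
              by_contra hkI
              exact hk ⟨k, Finset.mem_compl.mpr hkI, Relation.ReflTransGen.refl⟩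
            simp only [h1, Finset.sum_neg_distrib]
            linarith [hweq k]) i
      simp only [if_neg hi] at this
      linarith [hw0 i]
  intro i
  constructor
  · have h := hw0 i
    rw [hw] at h
    have h1 : vvec c E I i ≤ 1 / (1 - c) := by linarith
    rw [le_div_iff₀ hc] at h1
    linarith
  · rw [← hiff i, hw, sub_eq_zero, eq_comm]
end

section
/- For every node i ∈ I, v_i ≥ min_{j : (i,j) ∈ E} v_j (the minimum of v over the children of i), with equality if and only if the node i does not have access to Ī. -/
open Matrix Finset

lemma my_Pmat_mulVec {n : ℕ} (E : Finset (Fin n × Fin n)) (v : Fin n → ℝ) (i : Fin n) :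
    (Pmat E *ᵥ v) i =
      (outdeg E i : ℝ)⁻¹ * ∑ j ∈ Finset.univ.filter (fun j => (i, j) ∈ E), v j := by
  simp only [Matrix.mulVec, dotProduct, Pmat, Finset.sum_filter, Finset.mul_sum]
  refine Finset.sum_congr rfl fun j _ => ?_
  split_ifs <;> simp

lemma my_avg_le {n : ℕ} (E : Finset (Fin n × Fin n)) (hE : ∀ i, 0 < outdeg E i)
    (v : Fin n → ℝ) (i : Fin n) (b : ℝ) (h : ∀ j, (i, j) ∈ E → v j ≤ b) :
    (Pmat E *ᵥ v) i ≤ b := by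
  rw [my_Pmat_mulVec]
  have hd : (0 : ℝ) < outdeg E i := by exact_mod_cast hE i
  rw [inv_mul_le_iff₀ hd]
  have := Finset.sum_le_card_nsmul (Finset.univ.filter (fun j => (i, j) ∈ E)) v b
    (by intro j hj; exact h j (by simpa using hj))
  rw [nsmul_eq_mul] at this
  exact this

lemma my_le_avg {n : ℕ} (E : Finset (Fin n × Fin n)) (hE : ∀ i, 0 < outdeg E i)
    (v : Fin n → ℝ) (i : Fin n) (b : ℝ) (h : ∀ j, (i, j) ∈ E → b ≤ v j) :
    b ≤ (Pmat E *ᵥ v) i := by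
  have := my_avg_le E hE (-v) i (-b) (by intro j hj; simpa using h j hj)
  rw [Matrix.mulVec_neg] at this
  simpa using this

lemma my_avg_lt {n : ℕ} (E : Finset (Fin n × Fin n)) (hE : ∀ i, 0 < outdeg E i)
    (v : Fin n → ℝ) (i k : Fin n) (b : ℝ) (h : ∀ j, (i, j) ∈ E → v j ≤ b)
    (hk : (i, k) ∈ E) (hlt : v k < b) :
    (Pmat E *ᵥ v) i < b := by
  rw [my_Pmat_mulVec]
  have hd : (0 : ℝ) < outdeg E i := by exact_mod_cast hE i
  rw [inv_mul_lt_iff₀ hd]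
  have := Finset.sum_lt_sum (s := Finset.univ.filter (fun j => (i, j) ∈ E)) (f := v)
    (g := fun _ => b)
    (by intro j hj; exact h j (by simpa using hj)) ⟨k, by simpa using hk, hlt⟩
  rw [Finset.sum_const, nsmul_eq_mul] at this
  exact this

lemma my_upper {n : ℕ} (E : Finset (Fin n × Fin n)) (hE : ∀ i, 0 < outdeg E i)
    (c : ℝ) (hc0 : 0 < c) (hc1 : c < 1) (a : ℝ) (v : Fin n → ℝ)
    (h : ∀ i, v i ≤ c * (Pmat E *ᵥ v) i + a) (i : Fin n) : (1 - c) * v i ≤ a := by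
  obtain ⟨k, -, hk⟩ := Finset.exists_max_image Finset.univ v ⟨i, Finset.mem_univ i⟩
  have h1 := my_avg_le E hE v k (v k) (fun j _ => hk j (Finset.mem_univ j))
  have h2 := h k
  have h3 := hk i (Finset.mem_univ i)
  nlinarith

lemma my_eq {n : ℕ} (E : Finset (Fin n × Fin n)) (hE : ∀ i, 0 < outdeg E i)
    (c : ℝ) (hc0 : 0 < c) (hc1 : c < 1) (I : Finset (Fin n)) (i : Fin n) :
    vvec c E I i = c * (Pmat E *ᵥ vvec c E I) i + ind I i := by
  have hdet : (1 - c • Pmat E).det ≠ 0 := by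
    intro h0
    obtain ⟨w, hw, hw0⟩ := Matrix.exists_mulVec_eq_zero_iff.mpr h0
    apply hw
    have hw1 : ∀ i, w i = c * (Pmat E *ᵥ w) i := by
      intro i
      have := congrFun hw0 i
      simp only [Matrix.sub_mulVec, Matrix.one_mulVec, Matrix.smul_mulVec, Pi.sub_apply,
        Pi.smul_apply, smul_eq_mul, Pi.zero_apply] at this
      linarith
    funext i
    have a1 := my_upper E hE c hc0 hc1 0 w (fun i => by rw [add_zero]; exact (hw1 i).le) i
    have a2 := my_upper E hE c hc0 hc1 0 (-w) (fun i => by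
      rw [Matrix.mulVec_neg]
      simp only [Pi.neg_apply]
      linarith [hw1 i]) i
    simp only [Pi.neg_apply] at a2
    show w i = 0
    have : (1 - c) * w i = 0 := by linarith
    rcases mul_eq_zero.mp this with h | h
    · linarith
    · exact h
  have : (1 - c • Pmat E) *ᵥ vvec c E I = ind I := by
    rw [vvec, Matrix.mulVec_mulVec, Matrix.mul_nonsing_inv _ (isUnit_iff_ne_zero.mpr hdet),
      Matrix.one_mulVec]
  have := congrFun this i
  simp only [Matrix.sub_mulVec, Matrix.one_mulVec, Matrix.smul_mulVec, Pi.sub_apply,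
    Pi.smul_apply, smul_eq_mul] at this
  linarith

/-- Lemma 1(c): for every node `i ∈ I`, `v i ≥ min_{j child of i} v j`, with equality if
and only if `i` does not have access to the complement of `I`. -/
theorem stmt2 {n : ℕ} (hn : 1 ≤ n) (E : Finset (Fin n × Fin n))
    (hE : ∀ i, 0 < outdeg E i) (c : ℝ) (hc0 : 0 < c) (hc1 : c < 1)
    (I : Finset (Fin n)) :
    ∀ i ∈ I,
      (Finset.univ.filter (fun j => (i, j) ∈ E)).inf'
          (Finset.card_pos.mp (hE i)) (vvec c E I) ≤ vvec c E I i ∧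
      (vvec c E I i =
          (Finset.univ.filter (fun j => (i, j) ∈ E)).inf'
            (Finset.card_pos.mp (hE i)) (vvec c E I) ↔ ¬ access E i Iᶜ) := by
  intro i hi
  have heq := my_eq E hE c hc0 hc1 I
  set v := vvec c E I with hv
  have hind : ∀ k, k ∈ I → ind I k = 1 := fun k hk => by simp [ind, hk]
  have hind0 : ∀ k, k ∉ I → ind I k = 0 := fun k hk => by simp [ind, hk]
  have hind1 : ∀ k, ind I k ≤ 1 := fun k => by
    by_cases hk : k ∈ I
    · rw [hind k hk]
    · rw [hind0 k hk]; exact zero_le_one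
  have hup : ∀ k, (1 - c) * v k ≤ 1 :=
    my_upper E hE c hc0 hc1 1 v (fun k => by linarith [heq k, hind1 k])
  have hc : 0 < 1 - c := by linarith
  obtain ⟨k, hk, hkm⟩ := Finset.exists_mem_eq_inf' (Finset.card_pos.mp (hE i)) v
  set m := (Finset.univ.filter (fun j => (i, j) ∈ E)).inf' (Finset.card_pos.mp (hE i)) v with hm
  have hmin : ∀ j, (i, j) ∈ E → m ≤ v j := fun j hj =>
    Finset.inf'_le v (by simpa using hj)
  have hlow := my_le_avg E hE v i m hmin
  have hvi : 1 + c * m ≤ v i := by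
    rw [heq i, hind i hi]
    nlinarith
  have hmu : (1 - c) * m ≤ 1 := by rw [hkm]; exact hup k
  refine ⟨by linarith, ?_, ?_⟩
  · rintro h ⟨j, hj, hp⟩
    have hvM : (1 - c) * v i = 1 := le_antisymm (hup i) (by rw [← h] at hvi; linarith)
    have step : ∀ a, (1 - c) * v a = 1 → a ∈ I ∧ ∀ b, (a, b) ∈ E → (1 - c) * v b = 1 := by
      intro a ha
      have hle : ∀ b, v b ≤ v a := fun b =>
        le_of_mul_le_mul_left (by rw [ha]; exact hup b) hc
      have hpos : 0 < v a := by
        by_contra hneg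
        nlinarith
      have havg := my_avg_le E hE v a (v a) (fun b _ => hle b)
      constructor
      · by_contra haI
        have := heq a
        rw [hind0 a haI] at this
        nlinarith
      · intro b hb
        rcases (hle b).eq_or_lt with h1 | h1
        · rw [h1, ha]
        · exfalso
          have h2 := my_avg_lt E hE v a b (v a) (fun b _ => hle b) hb h1
          have := heq a
          have := hind1 a
          nlinarith
    have hvj : (1 - c) * v j = 1 := by
      clear hj
      induction hp with
      | refl => exact hvM
      | tail _ hbc ih => exact (step _ ih).2 _ hbc
    exact (Finset.mem_compl.mp hj) (step j hvj).1
  · intro hna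
    have hR : ∀ j, Relation.ReflTransGen (fun a b => (a, b) ∈ E) i j → j ∈ I := by
      intro j hj
      by_contra hjI
      exact hna ⟨j, Finset.mem_compl.mpr hjI, hj⟩
    classical
    obtain ⟨q, hq, hqm⟩ := Finset.exists_min_image
      (Finset.univ.filter (fun j => Relation.ReflTransGen (fun a b => (a, b) ∈ E) i j)) v
      ⟨i, by simpa using Relation.ReflTransGen.refl⟩
    have hq' : Relation.ReflTransGen (fun a b => (a, b) ∈ E) i q := by simpa using hq
    have hql := my_le_avg E hE v q (v q) (fun b hb => hqm b (by simpa using hq'.tail hb))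
    have h1 := heq q
    rw [hind q (hR q hq')] at h1
    have hkE : (i, k) ∈ E := by simpa using hk
    have h2 : v q ≤ v k := hqm k (by simpa using Relation.ReflTransGen.single hkE)
    have h3 : v i ≤ m := by
      rw [hkm]
      refine le_trans ?_ h2
      refine le_of_mul_le_mul_left ((hup i).trans ?_) hc
      nlinarith
    linarith
end

section
/- Removing a link: let i ∈ N with outdegree d_i ≥ 2, let j be a child of i attaining min_{k : (i,k) ∈ E} v_k, and let Ẽ = E ∖ {(i,j)}. Then π̃^T e_I ≥ π^T e_I, with equality if and only if v_k = v_j for every k with (i,k) ∈ E. -/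
open Matrix Finset

lemma Pmat_mulVec {n : ℕ} (E : Finset (Fin n × Fin n)) (w : Fin n → ℝ) (k : Fin n) :
    (Pmat E *ᵥ w) k =
      ((outdeg E k : ℝ))⁻¹ * ∑ l ∈ Finset.univ.filter (fun l => (k, l) ∈ E), w l := by
  simp only [Matrix.mulVec, dotProduct, Pmat, Finset.mul_sum, Finset.sum_filter]
  refine Finset.sum_congr rfl fun l _ => ?_
  split_ifs <;> simp

lemma M_mulVec {n : ℕ} (c : ℝ) (E : Finset (Fin n × Fin n)) (w : Fin n → ℝ) (k : Fin n) :
    ((1 - c • Pmat E) *ᵥ w) k = w k - c * (Pmat E *ᵥ w) k := by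
  simp [Matrix.sub_mulVec, Matrix.smul_mulVec]

lemma Pmat_mulVec_ge {n : ℕ} (E : Finset (Fin n × Fin n)) (hE : ∀ i, 0 < outdeg E i)
    (w : Fin n → ℝ) (a : ℝ) (h : ∀ l, a ≤ w l) (k : Fin n) : a ≤ (Pmat E *ᵥ w) k := by
  rw [Pmat_mulVec]
  have hd : (0 : ℝ) < outdeg E k := by exact_mod_cast hE k
  rw [inv_mul_eq_div, le_div_iff₀ hd]
  have := Finset.card_nsmul_le_sum (Finset.univ.filter (fun l => (k, l) ∈ E)) w a
    (fun l _ => h l)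
  rw [nsmul_eq_mul] at this
  unfold outdeg
  linarith

lemma minPrinciple {n : ℕ} (c : ℝ) (hc0 : 0 < c) (hc1 : c < 1) (E : Finset (Fin n × Fin n))
    (hE : ∀ i, 0 < outdeg E i) (w : Fin n → ℝ)
    (h : ∀ k, 0 ≤ ((1 - c • Pmat E) *ᵥ w) k) (k : Fin n) :
    ((1 - c • Pmat E) *ᵥ w) k ≤ w k ∧ 0 ≤ w k := by
  haveI : Nonempty (Fin n) := ⟨k⟩
  obtain ⟨m, hm⟩ := Finite.exists_min w
  have h1 := Pmat_mulVec_ge E hE w (w m) hm m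
  have h2 := h m
  rw [M_mulVec] at h2
  have h3 : 0 ≤ w m := by nlinarith
  have h4 : ∀ l, 0 ≤ w l := fun l => h3.trans (hm l)
  have h5 := Pmat_mulVec_ge E hE w 0 h4 k
  refine ⟨?_, h4 k⟩
  rw [M_mulVec]
  nlinarith

lemma M_isUnit {n : ℕ} (c : ℝ) (hc0 : 0 < c) (hc1 : c < 1) (E : Finset (Fin n × Fin n))
    (hE : ∀ i, 0 < outdeg E i) : IsUnit (1 - c • Pmat E) := by
  rw [← Matrix.mulVec_injective_iff_isUnit]
  intro x y hxy
  have h0 : (1 - c • Pmat E) *ᵥ (x - y) = 0 := by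
    rw [Matrix.mulVec_sub]; exact sub_eq_zero.mpr hxy
  have h0' : (1 - c • Pmat E) *ᵥ (y - x) = 0 := by
    rw [Matrix.mulVec_sub]; exact sub_eq_zero.mpr hxy.symm
  ext k
  have h1 := (minPrinciple c hc0 hc1 E hE (x - y) (by simp [h0]) k).2
  have h2 := (minPrinciple c hc0 hc1 E hE (y - x) (by simp [h0']) k).2
  simp only [Pi.sub_apply] at h1 h2
  linarith

lemma M_vvec {n : ℕ} (c : ℝ) (hc0 : 0 < c) (hc1 : c < 1) (E : Finset (Fin n × Fin n))
    (hE : ∀ i, 0 < outdeg E i) (I : Finset (Fin n)) :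
    (1 - c • Pmat E) *ᵥ vvec c E I = ind I := by
  unfold vvec
  rw [Matrix.mulVec_mulVec, Matrix.mul_nonsing_inv _
    ((Matrix.isUnit_iff_isUnit_det _).mp (M_isUnit c hc0 hc1 E hE)), Matrix.one_mulVec]

lemma prSet_eq {n : ℕ} (c : ℝ) (z : Fin n → ℝ) (E : Finset (Fin n × Fin n))
    (I : Finset (Fin n)) : prSet c z E I = (1 - c) * ∑ k, z k * vvec c E I k := by
  have h1 : prSet c z E I = pr c z E ⬝ᵥ ind I := by
    simp [prSet, dotProduct, ind]
  rw [h1]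
  unfold pr vvec
  rw [smul_dotProduct, smul_eq_mul, Matrix.mulVec_transpose, ← Matrix.dotProduct_mulVec]
  rfl

lemma erase_filter {n : ℕ} (E : Finset (Fin n × Fin n)) (i j : Fin n) :
    Finset.univ.filter (fun l => (i, l) ∈ E.erase (i, j)) =
      (Finset.univ.filter (fun l => (i, l) ∈ E)).erase j := by
  ext l
  simp

lemma erase_filter_ne {n : ℕ} (E : Finset (Fin n × Fin n)) (i j k : Fin n) (hk : k ≠ i) :
    Finset.univ.filter (fun l => (k, l) ∈ E.erase (i, j)) =
      Finset.univ.filter (fun l => (k, l) ∈ E) := by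
  ext l
  simp [hk]

/-- Proposition 7 (Removing a link): for `i` with at least two outlinks and `j` a child of
`i` attaining `min_{k child of i} v k`, removing the link `(i,j)` does not decrease the
PageRank of `I`, with equality if and only if `v k = v j` for every child `k` of `i`. -/
theorem stmt8 {n : ℕ} (hn : 1 ≤ n) (E : Finset (Fin n × Fin n))
    (hE : ∀ i, 0 < outdeg E i) (c : ℝ) (hc0 : 0 < c) (hc1 : c < 1)
    (z : Fin n → ℝ) (hz : ∀ i, 0 < z i) (hz1 : ∑ i, z i = 1)
    (I : Finset (Fin n)) (i : Fin n) (hd2 : 2 ≤ outdeg E i)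
    (j : Fin n) (hij : (i, j) ∈ E)
    (hjmin : ∀ k, (i, k) ∈ E → vvec c E I j ≤ vvec c E I k) :
    prSet c z E I ≤ prSet c z (E.erase (i, j)) I ∧
    (prSet c z (E.erase (i, j)) I = prSet c z E I ↔
      ∀ k, (i, k) ∈ E → vvec c E I k = vvec c E I j) := by
  set v := vvec c E I with hv
  set F := E.erase (i, j) with hF
  set w := vvec c F I - v with hw
  have hjm : j ∈ Finset.univ.filter (fun l => (i, l) ∈ E) := by simpa using hij
  have hdi : outdeg F i = outdeg E i - 1 := by
    unfold outdeg
    rw [hF, erase_filter, Finset.card_erase_of_mem hjm]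
  have hdk : ∀ k, k ≠ i → outdeg F k = outdeg E k := by
    intro k hk
    unfold outdeg
    rw [hF, erase_filter_ne E i j k hk]
  have hFd : ∀ k, 0 < outdeg F k := by
    intro k
    by_cases hk : k = i
    · subst hk; omega
    · rw [hdk k hk]; exact hE k
  have hMw : ∀ k, ((1 - c • Pmat F) *ᵥ w) k = c * ((Pmat F *ᵥ v) k - (Pmat E *ᵥ v) k) := by
    intro k
    have h1 := congrFun (M_vvec c hc0 hc1 F hFd I) k
    have h2 := congrFun (M_vvec c hc0 hc1 E hE I) k
    rw [hw, Matrix.mulVec_sub, Pi.sub_apply, h1, ← h2, M_mulVec, M_mulVec]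
    ring
  have hne : ∀ k, k ≠ i → ((1 - c • Pmat F) *ᵥ w) k = 0 := by
    intro k hk
    rw [hMw, Pmat_mulVec, Pmat_mulVec, hdk k hk, hF, erase_filter_ne E i j k hk]
    ring
  set S := Finset.univ.filter (fun l => (i, l) ∈ E) with hS
  set d : ℝ := (outdeg E i : ℝ) with hd
  have hd2' : (2 : ℝ) ≤ d := by rw [hd]; exact_mod_cast hd2
  set T := ∑ k ∈ S, (v k - v j) with hT
  have hTeq : T = ∑ k ∈ S, v k - d * v j := by
    rw [hT, Finset.sum_sub_distrib, Finset.sum_const, nsmul_eq_mul]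
    rfl
  have hi : ((1 - c • Pmat F) *ᵥ w) i = c * (T / (d * (d - 1))) := by
    have hdF : ((outdeg F i : ℕ) : ℝ) = d - 1 := by
      rw [hdi, Nat.cast_sub (by omega)]; simp [hd]
    have hsum : ∑ l ∈ S.erase j, v l = ∑ l ∈ S, v l - v j := by
      rw [← Finset.add_sum_erase S v hjm]; ring
    rw [hMw, Pmat_mulVec, Pmat_mulVec, hdF, hF, erase_filter, ← hS, hsum, ← hd, hTeq]
    have : d ≠ 0 := by linarith
    have : d - 1 ≠ 0 := by linarith
    field_simp
    ring
  have hterm : ∀ k ∈ S, 0 ≤ v k - v j := by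
    intro k hk
    have := hjmin k (by simpa [hS] using hk)
    linarith
  have hT0 : 0 ≤ T := Finset.sum_nonneg hterm
  have hD : 0 < d * (d - 1) := by nlinarith
  have hM0 : ∀ k, 0 ≤ ((1 - c • Pmat F) *ᵥ w) k := by
    intro k
    by_cases hk : k = i
    · subst hk; rw [hi]; positivity
    · rw [hne k hk]
  have hmp := minPrinciple c hc0 hc1 F hFd w hM0
  have hdiff : prSet c z F I - prSet c z E I = (1 - c) * ∑ k, z k * w k := by
    rw [prSet_eq, prSet_eq, ← mul_sub, ← Finset.sum_sub_distrib]
    congr 1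
    refine Finset.sum_congr rfl fun k _ => ?_
    rw [hw, Pi.sub_apply]
    ring
  have hnn : ∀ k ∈ Finset.univ, 0 ≤ z k * w k := fun k _ => mul_nonneg (hz k).le (hmp k).2
  have hc : 0 < 1 - c := by linarith
  have hTiff : T = 0 ↔ ∀ k, (i, k) ∈ E → v k = v j := by
    rw [hT, Finset.sum_eq_zero_iff_of_nonneg hterm]
    simp [hS, sub_eq_zero]
  refine ⟨?_, ?_⟩
  · have := mul_nonneg hc.le (Finset.sum_nonneg hnn)
    linarith
  rw [← hTiff, ← sub_eq_zero, hdiff, mul_eq_zero, or_iff_right hc.ne',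
    Finset.sum_eq_zero_iff_of_nonneg hnn]
  constructor
  · intro h
    have h1 : w i = 0 := by
      have := h i (Finset.mem_univ i)
      exact (mul_eq_zero.mp this).resolve_left (hz i).ne'
    have h2 := (hmp i).1
    rw [h1, hi] at h2
    by_contra hTn
    have hTp : 0 < T := lt_of_le_of_ne hT0 (Ne.symm hTn)
    have : 0 < c * (T / (d * (d - 1))) := by positivity
    linarith
  · intro h k _
    have hz0 : ∀ k, ((1 - c • Pmat F) *ᵥ w) k = 0 := by
      intro k
      by_cases hk : k = i
      · subst hk; rw [hi, h]; simp
      · exact hne k hk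
    have h2 := (minPrinciple c hc0 hc1 F hFd (-w) (by
      intro k; rw [Matrix.mulVec_neg, Pi.neg_apply, hz0]; simp) k).2
    have h1 := (hmp k).2
    rw [Pi.neg_apply] at h2
    have : w k = 0 := by linarith
    rw [this, mul_zero]
end
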